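/- Let p with 0.037 ≤ p < 1/2, let δ₁ = 2ρ(1−ρ) where ρ = √p/(√p+√(1−p)), let φ(x) = h(1/2 − √(x(1−x))), and let 0 ≤ R ≤ φ(δ₁). Set τ = h^{−1}(R) ∈ [0,1/2] and G = 1/2 − √(τ(1−τ)). Then max_{0≤ω≤G} ( −μ(R,1/2,ω) − A(ω) ) = −A(G) − R + 1 − h(G); moreover the maximum is attained at the right endpoint ω = G (for these rates G equals the linear-programming bound δ̄(R)). -/

import Mathlib

open Real

/-- Binary entropy function (base-2 logarithms). -/
noncomputable def H (x : ℝ) : ℝ := -(x * logb 2 x) - (1 - x) * logb 2 (1 - x)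

/-- Inverse of the binary entropy function, taking values in `[0,1/2]`. -/
noncomputable def Hinv (y : ℝ) : ℝ := sInf {x | x ∈ Set.Icc (0:ℝ) (1/2) ∧ H x = y}

/-- `A(ω) = ω log₂(2√(p(1−p)))`. -/
noncomputable def Afun (p ω : ℝ) : ℝ := ω * logb 2 (2 * Real.sqrt (p * (1 - p)))

/-- `q(α,τ,ω) = h(τ) + ∫₀^ω log₂[(P + √(P² − 4Qy²))/(2Q)] dy`, where
`P = α(1−α) − τ(1−τ) − y(1−2y)` and `Q = (α−y)(1−α−y)` — the exponent of the Hahn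
polynomial. -/
noncomputable def qfun (α τ ω : ℝ) : ℝ :=
  H τ + ∫ y in (0:ℝ)..ω,
    logb 2 (((α * (1 - α) - τ * (1 - τ) - y * (1 - 2*y)) +
      Real.sqrt ((α * (1 - α) - τ * (1 - τ) - y * (1 - 2*y))^2
        - 4 * ((α - y) * (1 - α - y)) * y^2)) / (2 * ((α - y) * (1 - α - y))))

/-- `μ(R,α,ω) = R − 1 + h(τ) + 2h(α) − 2q(α,τ,ω/2) − ω − (1−ω)h((α−ω/2)/(1−ω))`, where
`τ ∈ [0,1/2]` satisfies `h(τ) = h(α) − 1 + R` (Litsyn's distance-distribution exponent). -/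
noncomputable def mu (R α ω : ℝ) : ℝ :=
  R - 1 + H (Hinv (H α - 1 + R)) + 2 * H α - 2 * qfun α (Hinv (H α - 1 + R)) (ω/2)
    - ω - (1 - ω) * H ((α - ω/2) / (1 - ω))

/-- `φ(x) = h(1/2 − √(x(1−x)))`. -/
noncomputable def phi (x : ℝ) : ℝ := H (1/2 - Real.sqrt (x * (1 - x)))

/-- The larger root `w` of `(1 - y) w² - c w + y = 0`. -/
noncomputable def krawtchoukRatio (c y : ℝ) : ℝ :=
  (c + √(c ^ 2 - 4 * (y * (1 - y)))) / (2 * (1 - y))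

theorem H_eq_binEntropy_div (x : ℝ) : H x = binEntropy x / log 2 := by
  simp only [H, binEntropy, logb, log_inv]
  ring

theorem H_half : H (1 / 2) = 1 := by
  rw [H_eq_binEntropy_div, one_div, binEntropy_two_inv, div_self (log_pos one_lt_two).ne']

theorem H_le_one (x : ℝ) : H x ≤ 1 := by
  rw [H_eq_binEntropy_div, div_le_one (log_pos one_lt_two)]
  exact binEntropy_le_log_two

theorem H_strictMonoOn : StrictMonoOn H (Set.Icc 0 (1 / 2)) := by
  intro x hx y hy hxy
  rw [H_eq_binEntropy_div, H_eq_binEntropy_div]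
  rw [one_div] at hx hy
  exact div_lt_div_of_pos_right (binEntropy_strictMonoOn hx hy hxy) (log_pos one_lt_two)

theorem Hinv_spec {R : ℝ} (h0 : 0 ≤ R) (h1 : R ≤ 1) :
    Hinv R ∈ Set.Icc (0 : ℝ) (1 / 2) ∧ H (Hinv R) = R := by
  have hcont : Continuous H := by
    rw [show H = fun x => binEntropy x / log 2 from funext H_eq_binEntropy_div]
    fun_prop
  obtain ⟨x, hx, hxR⟩ := intermediate_value_Icc (a := (0 : ℝ)) (b := 1 / 2) (by norm_num)
    hcont.continuousOn (show R ∈ Set.Icc (H 0) (H (1 / 2)) by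
      rw [H_half, H_eq_binEntropy_div, binEntropy_zero, zero_div]; exact ⟨h0, h1⟩)
  have hset : {x | x ∈ Set.Icc (0 : ℝ) (1 / 2) ∧ H x = R} = {x} := by
    ext y
    constructor
    · rintro ⟨hy, hyR⟩
      exact H_strictMonoOn.injOn hy hx (hyR.trans hxR.symm)
    · rintro rfl
      exact ⟨hx, hxR⟩
  rw [Hinv, hset, csInf_singleton]
  exact ⟨hx, hxR⟩

theorem krawtchoukRatio_pos {c y : ℝ} (hc : 0 < c) (hy : y < 1) : 0 < krawtchoukRatio c y := by
  have : 0 < 1 - y := by linarith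
  unfold krawtchoukRatio
  positivity

theorem krawtchoukRatio_lt_one {c y : ℝ} (hc : c < 1) (hy : y ≤ 1 / 2) :
    krawtchoukRatio c y < 1 := by
  rw [krawtchoukRatio, div_lt_one (by linarith), ← lt_sub_iff_add_lt', sqrt_lt' (by linarith)]
  nlinarith

theorem krawtchoukRatio_quadratic {c y : ℝ} (hy : y < 1) (hD : 4 * (y * (1 - y)) ≤ c ^ 2) :
    (1 - y) * krawtchoukRatio c y ^ 2 - c * krawtchoukRatio c y + y = 0 := by
  have hs := sq_sqrt (sub_nonneg.2 hD)
  have : 1 - y ≠ 0 := by linarith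
  rw [krawtchoukRatio]
  set s := √(c ^ 2 - 4 * (y * (1 - y)))
  field_simp
  linear_combination hs

theorem le_krawtchoukRatio {c x y : ℝ} (hy : y < 1) (hx : (1 - y) * x ^ 2 - c * x + y ≤ 0) :
    x ≤ krawtchoukRatio c y := by
  have h1 : 0 < 1 - y := by linarith
  rw [krawtchoukRatio, le_div_iff₀ (by linarith), ← sub_le_iff_le_add']
  exact le_sqrt_of_sq_le (by nlinarith)

theorem krawtchoukRatio_continuousOn (c : ℝ) :
    ContinuousOn (krawtchoukRatio c) (Set.Iio 1) := by
  unfold krawtchoukRatio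
  refine ContinuousOn.div (by fun_prop) (by fun_prop) fun y hy => ?_
  have : y < 1 := hy
  linarith

theorem krawtchoukRatio_differentiableAt {c y : ℝ} (hy : y < 1)
    (hD : 4 * (y * (1 - y)) < c ^ 2) : DifferentiableAt ℝ (krawtchoukRatio c) y := by
  unfold krawtchoukRatio
  refine DifferentiableAt.div ?_ (by fun_prop) (by linarith)
  exact (DifferentiableAt.sqrt (by fun_prop) (by linarith)).const_add c

theorem mul_one_sub_le_mul_one_sub {y G : ℝ} (hy : y ≤ G) (hG : G ≤ 1 / 2) :
    y * (1 - y) ≤ G * (1 - G) := by nlinarith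

theorem log_krawtchoukRatio_continuousOn {c : ℝ} (hc : 0 < c) :
    ContinuousOn (fun y => log (krawtchoukRatio c y)) (Set.Iio 1) :=
  (krawtchoukRatio_continuousOn c).log fun _ hy => (krawtchoukRatio_pos hc hy).ne'

theorem krawtchoukRatio_antiderivative {τ y : ℝ} (hτ0 : 0 < τ) (hτ : τ < 1 / 2) (hy : y ≤ 1 / 2)
    (hD : 4 * (y * (1 - y)) < (1 - 2 * τ) ^ 2) :
    HasDerivAt (fun y => y * log (krawtchoukRatio (1 - 2 * τ) y)
      - τ * log (1 - krawtchoukRatio (1 - 2 * τ) y)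
      - (1 - τ) * log (1 + krawtchoukRatio (1 - 2 * τ) y))
      (log (krawtchoukRatio (1 - 2 * τ) y)) y := by
  have hpos := krawtchoukRatio_pos (c := 1 - 2 * τ) (y := y) (by linarith) (by linarith)
  have hlt := krawtchoukRatio_lt_one (c := 1 - 2 * τ) (by linarith) hy
  have hq := krawtchoukRatio_quadratic (c := 1 - 2 * τ) (by linarith) hD.le
  have hw := (krawtchoukRatio_differentiableAt (c := 1 - 2 * τ) (by linarith) hD).hasDerivAt
  have h := (((hasDerivAt_id y).mul (hw.log hpos.ne')).sub
    (((hw.const_sub 1).log (by linarith)).const_mul τ)).sub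
    (((hw.const_add 1).log (by linarith)).const_mul (1 - τ))
  refine h.congr_deriv ?_
  simp only [id]
  set w := krawtchoukRatio (1 - 2 * τ) y
  have h1 : 1 - w ≠ 0 := by linarith
  have h2 : 1 + w ≠ 0 := by linarith
  have h3 : w ≠ 0 := hpos.ne'
  field_simp
  linear_combination (deriv (krawtchoukRatio (1 - 2 * τ)) y) * hq

theorem integral_log_krawtchoukRatio {τ G : ℝ} (hτ0 : 0 ≤ τ) (hτ : τ < 1 / 2) (hG0 : 0 ≤ G)
    (hG : G ≤ 1 / 2) (hGτ : (1 - 2 * τ) ^ 2 = 4 * (G * (1 - G))) :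
    2 * ∫ y in (0 : ℝ)..G, log (krawtchoukRatio (1 - 2 * τ) y) =
      log 2 - binEntropy τ - binEntropy G := by
  rcases hτ0.eq_or_lt with rfl | hτ0
  · have hG' : G = 2⁻¹ := by nlinarith
    have hz : Set.EqOn (fun y => log (krawtchoukRatio (1 - 2 * 0) y)) (fun _ => 0)
        (Set.uIcc 0 G) := by
      intro y hy
      rw [Set.uIcc_of_le hG0] at hy
      have hy1 := hy.2.trans hG
      have h1 : 1 - y ≠ 0 := by linarith
      have hr : krawtchoukRatio (1 - 2 * 0) y = 1 := by
        rw [krawtchoukRatio, show (1 - 2 * 0 : ℝ) ^ 2 - 4 * (y * (1 - y)) = (1 - 2 * y) ^ 2 by ring,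
          sqrt_sq (by linarith)]
        field_simp
        ring
      simp only [hr, log_one]
    rw [intervalIntegral.integral_congr hz, hG', binEntropy_two_inv, binEntropy_zero]
    simp
  have hsub : Set.Icc 0 G ⊆ Set.Iio 1 := fun y hy => by
    have := hy.2
    exact Set.mem_Iio.2 (by linarith)
  have hwc := (krawtchoukRatio_continuousOn (1 - 2 * τ)).mono hsub
  have hlc := (log_krawtchoukRatio_continuousOn (c := 1 - 2 * τ) (by linarith)).mono hsub
  have hpos : ∀ y ∈ Set.Icc 0 G, 0 < krawtchoukRatio (1 - 2 * τ) y := fun y hy =>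
    krawtchoukRatio_pos (by linarith) (hsub hy)
  have hlt : ∀ y ∈ Set.Icc 0 G, krawtchoukRatio (1 - 2 * τ) y < 1 := fun y hy =>
    krawtchoukRatio_lt_one (by linarith) (hy.2.trans hG)
  rw [intervalIntegral.integral_eq_sub_of_hasDerivAt_of_le hG0
    (f := fun y => y * log (krawtchoukRatio (1 - 2 * τ) y)
      - τ * log (1 - krawtchoukRatio (1 - 2 * τ) y)
      - (1 - τ) * log (1 + krawtchoukRatio (1 - 2 * τ) y))]
  · have hw0 : krawtchoukRatio (1 - 2 * τ) 0 = 1 - 2 * τ := by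
      rw [krawtchoukRatio, zero_mul, mul_zero, sub_zero, sqrt_sq (by linarith)]
      ring
    have hwG : krawtchoukRatio (1 - 2 * τ) G = (1 - 2 * τ) / (2 * (1 - G)) := by
      rw [krawtchoukRatio, hGτ, sub_self, sqrt_zero, add_zero]
    have hG1 : 0 < 1 - G := by linarith
    have hGpos : 0 < G := by nlinarith
    have hGmem : G ∈ Set.Icc 0 G := ⟨hG0, le_rfl⟩
    have hpG := hpos G hGmem
    have hlG := hlt G hGmem
    simp only [hw0]
    set w := krawtchoukRatio (1 - 2 * τ) G
    have hwsq : w ^ 2 = G / (1 - G) := by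
      rw [hwG]
      field_simp
      linear_combination hGτ
    have e1 : 2 * log w = log G - log (1 - G) := by
      rw [← log_div hGpos.ne' hG1.ne', ← hwsq, log_pow]
      norm_num
    have e2 : 2 * log (1 - w) = log 2 + log τ - log (1 - G) := by
      rw [← log_mul two_ne_zero hτ0.ne', ← log_div (by positivity) hG1.ne',
        show 2 * τ / (1 - G) = (1 - w) ^ 2 by
          rw [sub_sq, hwsq, hwG]
          field_simp
          ring, log_pow]
      norm_num
    have e3 : 2 * log (1 + w) = log 2 + log (1 - τ) - log (1 - G) := by
      have : 0 < 1 - τ := by linarith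
      rw [← log_mul two_ne_zero this.ne', ← log_div (by positivity) hG1.ne',
        show 2 * (1 - τ) / (1 - G) = (1 + w) ^ 2 by
          rw [add_sq, hwsq, hwG]
          field_simp
          ring, log_pow]
      norm_num
    have e4 : log (1 - (1 - 2 * τ)) = log 2 + log τ := by
      rw [← log_mul two_ne_zero hτ0.ne']
      ring_nf
    have e5 : log (1 + (1 - 2 * τ)) = log 2 + log (1 - τ) := by
      rw [← log_mul two_ne_zero (by linarith)]
      ring_nf
    rw [e4, e5]
    simp only [binEntropy, log_inv]
    linear_combination G * e1 - τ * e2 - (1 - τ) * e3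
  · refine ((continuousOn_id.mul hlc).sub (continuousOn_const.mul
      ((continuousOn_const.sub hwc).log fun y hy => ?_))).sub
      (continuousOn_const.mul ((continuousOn_const.add hwc).log fun y hy => ?_))
    · exact (sub_pos.2 (hlt y hy)).ne'
    · exact (add_pos one_pos (hpos y hy)).ne'
  · intro y hy
    refine krawtchoukRatio_antiderivative hτ0 hτ (hy.2.le.trans hG) ?_
    have h1 := hy.2
    rw [hGτ]
    nlinarith
  · exact hlc.intervalIntegrable_of_Icc hG0

/-- At `α = 1/2` the Hahn exponent integrand is the square of the Krawtchouk one. -/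
theorem hahn_integrand_half {τ y : ℝ} (hτ : τ ≤ 1 / 2) (hy : y < 1 / 2)
    (hD : 4 * (2 * y * (1 - 2 * y)) ≤ (1 - 2 * τ) ^ 2) :
    (((1 / 2 * (1 - 1 / 2) - τ * (1 - τ) - y * (1 - 2 * y)) +
      √((1 / 2 * (1 - 1 / 2) - τ * (1 - τ) - y * (1 - 2 * y)) ^ 2
        - 4 * ((1 / 2 - y) * (1 - 1 / 2 - y)) * y ^ 2)) / (2 * ((1 / 2 - y) * (1 - 1 / 2 - y))))
      = krawtchoukRatio (1 - 2 * τ) (2 * y) ^ 2 := by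
  have hs := sq_sqrt (sub_nonneg.2 hD)
  rw [krawtchoukRatio]
  set s := √((1 - 2 * τ) ^ 2 - 4 * (2 * y * (1 - 2 * y)))
  have hc : 0 ≤ 1 - 2 * τ := by linarith
  have hs0 : 0 ≤ s := sqrt_nonneg _
  rw [show (1 / 2 * (1 - 1 / 2) - τ * (1 - τ) - y * (1 - 2 * y)) ^ 2
        - 4 * ((1 / 2 - y) * (1 - 1 / 2 - y)) * y ^ 2 = ((1 - 2 * τ) * s / 4) ^ 2 by
      linear_combination (-(1 - 2 * τ) ^ 2 / 16) * hs, sqrt_sq (by positivity)]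
  have h1 : 1 - 2 * y ≠ 0 := by linarith
  rw [show 2 * ((1 / 2 - y) * (1 - 1 / 2 - y)) = (1 - 2 * y) ^ 2 / 2 by ring, div_pow,
    div_eq_div_iff (by positivity) (by positivity)]
  linear_combination (-(1 - 2 * y) ^ 2 / 2) * hs

theorem neg_mu_half {R G ω : ℝ} (hR0 : 0 ≤ R) (hR1 : R ≤ 1) (hω0 : 0 ≤ ω) (hω : ω ≤ G)
    (hG : G ≤ 1 / 2) (hGτ : (1 - 2 * Hinv R) ^ 2 = 4 * (G * (1 - G))) :
    -mu R (1 / 2) ω =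
      2 / log 2 * ∫ y in (0 : ℝ)..ω, log (krawtchoukRatio (1 - 2 * Hinv R) y) := by
  obtain ⟨⟨hτ0, hτ⟩, hHτ⟩ := Hinv_spec hR0 hR1
  have hω1 : 1 - ω ≠ 0 := by linarith
  have hcongr : Set.EqOn (fun y => logb 2 (((1 / 2 * (1 - 1 / 2) - Hinv R * (1 - Hinv R)
      - y * (1 - 2 * y)) + √((1 / 2 * (1 - 1 / 2) - Hinv R * (1 - Hinv R) - y * (1 - 2 * y)) ^ 2
        - 4 * ((1 / 2 - y) * (1 - 1 / 2 - y)) * y ^ 2)) / (2 * ((1 / 2 - y) * (1 - 1 / 2 - y)))))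
      (fun y => 2 / log 2 * log (krawtchoukRatio (1 - 2 * Hinv R) (2 * y)))
      (Set.uIcc 0 (ω / 2)) := by
    intro y hy
    rw [Set.uIcc_of_le (by linarith)] at hy
    have hyω := hy.2
    have hD := mul_one_sub_le_mul_one_sub (y := 2 * y) (by linarith) hG
    simp only
    rw [hahn_integrand_half hτ (by linarith) (by rw [hGτ]; linarith), logb, log_pow]
    push_cast
    ring
  have hscale := intervalIntegral.mul_integral_comp_mul_left (a := (0 : ℝ)) (b := ω / 2)
    (f := fun y => log (krawtchoukRatio (1 - 2 * Hinv R) y)) 2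
  rw [mul_zero, mul_div_cancel₀ ω two_ne_zero] at hscale
  rw [mu, qfun, H_half, show (1 : ℝ) - 1 + R = R by ring, hHτ,
    show (1 / 2 - ω / 2) / (1 - ω) = 1 / 2 by field_simp, H_half,
    intervalIntegral.integral_congr hcongr, intervalIntegral.integral_const_mul, ← hscale]
  ring

theorem sub_mul_log_le_integral_log_krawtchoukRatio {c γ G ω : ℝ} (hc : 0 < c) (hG : G ≤ 1 / 2)
    (hGc : c ^ 2 = 4 * (G * (1 - G))) (hγ0 : 0 < γ) (hγ : γ ≤ G / (1 - G)) (hω : ω ≤ G) :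
    (G - ω) * log γ ≤ 2 * ∫ y in ω..G, log (krawtchoukRatio c y) := by
  have hG1 : 0 < 1 - G := by linarith
  have hlc := (log_krawtchoukRatio_continuousOn hc).mono
    fun y (hy : y ∈ Set.Icc ω G) => Set.mem_Iio.2 (by linarith [hy.2])
  have hpt : ∀ y ∈ Set.Icc ω G, log γ / 2 ≤ log (krawtchoukRatio c y) := by
    intro y hy
    have hyG := hy.2
    have hx0 : 0 < c / (2 * (1 - G)) := by positivity
    have hx : (c / (2 * (1 - G))) ^ 2 = G / (1 - G) := by
      rw [div_pow, hGc]
      field_simp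
      ring
    have hle : c / (2 * (1 - G)) ≤ krawtchoukRatio c y := by
      refine le_krawtchoukRatio (by linarith) ?_
      have hcx : c * (c / (2 * (1 - G))) = 2 * G := by
        rw [← mul_div_assoc, ← sq, hGc]
        field_simp
        ring
      rw [hcx, hx, show (1 - y) * (G / (1 - G)) - 2 * G + y =
        (y - G) * (1 - 2 * G) / (1 - G) by field_simp; ring]
      exact div_nonpos_of_nonpos_of_nonneg
        (mul_nonpos_of_nonpos_of_nonneg (by linarith) (by linarith)) hG1.le
    have h1 := log_le_log hx0 hle
    have h2 := log_le_log hγ0 hγ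
    rw [← hx, log_pow] at h2
    push_cast at h2
    linarith
  have hmono := intervalIntegral.integral_mono_on (μ := MeasureTheory.volume) hω
    intervalIntegrable_const
    (hlc.intervalIntegrable_of_Icc hω) hpt
  rw [intervalIntegral.integral_const, smul_eq_mul] at hmono
  linarith

theorem two_rho_mul_one_sub_rho {p ρ : ℝ} (hp0 : 0 < p) (hp1 : p < 1)
    (hρ : ρ = √p / (√p + √(1 - p))) :
    2 * ρ * (1 - ρ) = 2 * √(p * (1 - p)) / (1 + 2 * √(p * (1 - p))) := by
  have hq : 0 < 1 - p := by linarith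
  have ha := sqrt_pos.2 hp0
  have hb := sqrt_pos.2 hq
  have ha2 := sq_sqrt hp0.le
  have hb2 := sq_sqrt hq.le
  rw [hρ, sqrt_mul hp0.le]
  have hsum : 1 + 2 * (√p * √(1 - p)) = (√p + √(1 - p)) ^ 2 := by
    linear_combination -ha2 - hb2
  rw [hsum]
  field_simp
  ring

theorem le_half_sub_sqrt_of_le_half_sub_sqrt {x τ : ℝ} (hx : x ≤ 1 / 2)
    (h : τ ≤ 1 / 2 - √(x * (1 - x))) : x ≤ 1 / 2 - √(τ * (1 - τ)) := by
  have h1 : √(x * (1 - x)) ≤ 1 / 2 - τ := by linarith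
  have h2 := (sqrt_le_left (by linarith [sqrt_nonneg (x * (1 - x))])).1 h1
  have h3 : √(τ * (1 - τ)) ≤ 1 / 2 - x := (sqrt_le_left (by linarith)).2 (by nlinarith)
  linarith

/-- Let `0.037 ≤ p < 1/2`, `δ₁ = 2ρ(1−ρ)` where `ρ = √p/(√p+√(1−p))`, and `0 ≤ R ≤ φ(δ₁)`.
Set `τ = h⁻¹(R) ∈ [0,1/2]` and `G = 1/2 − √(τ(1−τ))`. Then
`max_{0≤ω≤G}(−μ(R,1/2,ω) − A(ω)) = −A(G) − R + 1 − h(G)`, and moreover the maximum is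
attained at the right endpoint `ω = G` (for these rates `G` equals the LP bound `δ̄(R)`). -/
theorem low_rate_union_bound_exponent (p ρ δ₁ R τ G : ℝ)
    (hp : 0.037 ≤ p) (hp' : p < 1/2)
    (hρ : ρ = Real.sqrt p / (Real.sqrt p + Real.sqrt (1 - p)))
    (hδ₁ : δ₁ = 2 * ρ * (1 - ρ))
    (hR0 : 0 ≤ R) (hR1 : R ≤ phi δ₁)
    (hτ : τ = Hinv R) (hG : G = 1/2 - Real.sqrt (τ * (1 - τ))) :
    sSup ((fun ω => -mu R (1/2) ω - Afun p ω) '' Set.Icc 0 G)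
        = -Afun p G - R + 1 - H G ∧
      -mu R (1/2) G - Afun p G = -Afun p G - R + 1 - H G := by
  have hR1' : R ≤ 1 := hR1.trans (H_le_one _)
  have hp0 : 0 < p := by linarith
  obtain ⟨⟨hτ0, hτ2⟩, hHτ⟩ := Hinv_spec hR0 hR1'
  rw [← hτ] at hτ0 hτ2 hHτ
  set γ := 2 * √(p * (1 - p)) with hγ
  have hγ0 : 0 < γ := by
    have : 0 < p * (1 - p) := mul_pos hp0 (by linarith)
    positivity
  have hγ1 : γ < 1 := by
    have : √(p * (1 - p)) < 1 / 2 := (sqrt_lt' (by norm_num)).2 (by nlinarith)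
    linarith
  have hδγ : δ₁ = γ / (1 + γ) := by rw [hδ₁, two_rho_mul_one_sub_rho hp0 (by linarith) hρ]
  have hδ0 : 0 < δ₁ := by rw [hδγ]; positivity
  have hδ2 : δ₁ < 1 / 2 := by rw [hδγ, div_lt_iff₀ (by linarith)]; linarith
  have hsδ : √(δ₁ * (1 - δ₁)) ≤ 1 / 2 :=
    (sqrt_le_left (by norm_num)).2 (by nlinarith [sq_nonneg (1 - 2 * δ₁)])
  have hsδ0 : 0 < √(δ₁ * (1 - δ₁)) := sqrt_pos.2 (mul_pos hδ0 (by linarith))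
  have hτδ : τ ≤ 1 / 2 - √(δ₁ * (1 - δ₁)) := by
    rw [← H_strictMonoOn.le_iff_le ⟨hτ0, hτ2⟩ ⟨by linarith, by linarith⟩, hHτ]
    exact hR1
  have hδG : δ₁ ≤ G := hG ▸ le_half_sub_sqrt_of_le_half_sub_sqrt hδ2.le hτδ
  have hG0 : 0 ≤ G := hδ0.le.trans hδG
  have hG2 : G ≤ 1 / 2 := by rw [hG]; linarith [sqrt_nonneg (τ * (1 - τ))]
  have hGτ : (1 - 2 * τ) ^ 2 = 4 * (G * (1 - G)) := by
    have := sq_sqrt (mul_nonneg hτ0 (by linarith : 0 ≤ 1 - τ))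
    rw [hG]
    linear_combination 4 * this
  have hγG : γ ≤ G / (1 - G) := by
    rw [hδγ, div_le_iff₀ (by linarith)] at hδG
    rw [le_div_iff₀ (by linarith)]
    linarith
  have hl2 : 0 < log 2 := log_pos one_lt_two
  have hmu : ∀ ω ∈ Set.Icc 0 G, -mu R (1 / 2) ω =
      2 / log 2 * ∫ y in (0 : ℝ)..ω, log (krawtchoukRatio (1 - 2 * τ) y) := by
    rw [hτ] at hGτ ⊢
    exact fun ω hω => neg_mu_half hR0 hR1' hω.1 hω.2 hG2 hGτ
  have hGmem : G ∈ Set.Icc 0 G := ⟨hG0, le_rfl⟩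
  have hval : -mu R (1 / 2) G - Afun p G = -Afun p G - R + 1 - H G := by
    have hint := integral_log_krawtchoukRatio hτ0 (by linarith) hG0 hG2 hGτ
    rw [hmu G hGmem, ← hHτ, H_eq_binEntropy_div, H_eq_binEntropy_div]
    field_simp
    linear_combination hint
  refine ⟨?_, hval⟩
  rw [← hval]
  refine IsGreatest.csSup_eq ⟨⟨G, hGmem, rfl⟩, ?_⟩
  rintro _ ⟨ω, hω, rfl⟩
  have hmax := sub_mul_log_le_integral_log_krawtchoukRatio (by linarith : 0 < 1 - 2 * τ) hG2 hGτ
    hγ0 hγG hω.2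
  have hii : ∀ a b, a ≤ b → b ≤ G → IntervalIntegrable
      (fun y => log (krawtchoukRatio (1 - 2 * τ) y)) MeasureTheory.volume a b := fun a b hab hb =>
    ((log_krawtchoukRatio_continuousOn (by linarith)).mono fun y hy =>
      Set.mem_Iio.2 (by linarith [hy.2])).intervalIntegrable_of_Icc hab
  have hadd := intervalIntegral.integral_add_adjacent_intervals
    (hii 0 ω hω.1 hω.2) (hii ω G hω.2 le_rfl)
  simp only
  rw [hmu G hGmem, hmu ω hω, ← hadd, Afun, Afun, ← hγ, logb]
  have := div_le_div_of_nonneg_right hmax hl2.le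
  have e : ∀ a b : ℝ, 2 / log 2 * (a + b) - G * (log γ / log 2) =
      2 / log 2 * a - ω * (log γ / log 2) + (2 * b / log 2 - (G - ω) * log γ / log 2) := by
    intro a b
    ring
  rw [e]
  linarith
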